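/- Define for X > 0: ρ₀(X) := 1 − (sin(πX)/(πX))² + (sin(πX) − πX·cos(πX))·(π − 2·Si(πX))/(2π²X²) and ρ₁(X) := (1/12)·( −4·sin²(πX) − 2·(sin(πX) − πX·cos(πX))²/(π²X²) − (π − 2·Si(πX))·(sin(πX) + πX·cos(πX)) ). Then for all X > 0 the function X ↦ X²·ρ₀(X) is twice differentiable and ρ₁(X) = −(1/6)·(d²/dX²)(X²·ρ₀(X)). -/

import Mathlib

open Real intervalIntegral

/-- The sine integral `Si(x) = ∫₀^x (sin t)/t dt`. -/
noncomputable def Si (x : ℝ) : ℝ := ∫ t in (0 : ℝ)..x, Real.sin t / t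

/-- The limiting bulk two-point correlation function of the COE (β = 1). -/
noncomputable def rho0COE (X : ℝ) : ℝ :=
  1 - (Real.sin (π * X) / (π * X)) ^ 2 +
    (Real.sin (π * X) - π * X * Real.cos (π * X)) * (π - 2 * Si (π * X)) / (2 * π ^ 2 * X ^ 2)

/-- The coefficient of `N⁻²` in the large-`N` expansion of the bulk-scaled COE two-point
correlation function. -/
noncomputable def rho1COE (X : ℝ) : ℝ :=
  (1 / 12) *
    (-4 * Real.sin (π * X) ^ 2 -
      2 * (Real.sin (π * X) - π * X * Real.cos (π * X)) ^ 2 / (π ^ 2 * X ^ 2) -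
      (π - 2 * Si (π * X)) * (Real.sin (π * X) + π * X * Real.cos (π * X)))

theorem Si_hasDerivAt (x : ℝ) (hx : 0 < x) : HasDerivAt Si (Real.sin x / x) x := by
  have hi : IntervalIntegrable (fun t : ℝ => Real.sin t / t) MeasureTheory.volume 0 x := by
    have hc : IntervalIntegrable Real.sinc MeasureTheory.volume 0 x :=
      Real.continuous_sinc.intervalIntegrable 0 x
    refine hc.congr_uIoo ?_
    intro t ht
    rw [Set.uIoo_of_le hx.le] at ht
    exact Real.sinc_of_ne_zero ht.1.ne'
  have hm : Measurable (fun t : ℝ => Real.sin t / t) :=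
    Real.measurable_sin.div measurable_id
  have hca : ContinuousAt (fun t : ℝ => Real.sin t / t) x :=
    Real.continuous_sin.continuousAt.div continuousAt_id hx.ne'
  exact integral_hasDerivAt_right hi hm.stronglyMeasurable.stronglyMeasurableAtFilter hca

/-- First derivative of `X²ρ₀`. -/
theorem first_deriv (X : ℝ) (hX : 0 < X) :
    HasDerivAt (fun t => t ^ 2 * rho0COE t)
      (2 * X - Real.sin (π * X) * Real.cos (π * X) / π
        + X * Real.sin (π * X) * (π - 2 * Si (π * X)) / 2
        - Real.sin (π * X) ^ 2 / (π ^ 2 * X)) X := by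
  have hp := Real.pi_pos
  have hl : HasDerivAt (fun t : ℝ => π * t) π X := by
    simpa using (hasDerivAt_id X).const_mul π
  have hs := hl.sin
  have hc := hl.cos
  have hS : HasDerivAt (fun t : ℝ => Si (π * t)) (Real.sin (π * X) / (π * X) * π) X :=
    (Si_hasDerivAt (π * X) (by positivity)).comp X hl
  have hP := (hS.const_mul 2).const_sub π
  have hF := (((hasDerivAt_id X).pow 2).sub ((hs.pow 2).div_const (π ^ 2))).add
    (((hs.sub (hl.mul hc)).mul hP).div_const (2 * π ^ 2))
  have hF2 := hF.congr_of_eventuallyEq (f₁ := fun t => t ^ 2 * rho0COE t) (by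
    filter_upwards [lt_mem_nhds hX] with t ht
    simp only [rho0COE, Pi.add_apply, Pi.sub_apply, Pi.mul_apply, Pi.pow_apply, id]
    have := ht.ne'
    field_simp)
  refine hF2.congr_deriv ?_
  simp only [Pi.add_apply, Pi.sub_apply, Pi.mul_apply, Pi.pow_apply, id]
  field_simp
  ring

/-- Second derivative of `X²ρ₀`. -/
theorem second_deriv (X : ℝ) (hX : 0 < X) :
    HasDerivAt (deriv fun t => t ^ 2 * rho0COE t) (-6 * rho1COE X) X := by
  have hp := Real.pi_pos
  have hl : HasDerivAt (fun t : ℝ => π * t) π X := by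
    simpa using (hasDerivAt_id X).const_mul π
  have hs := hl.sin
  have hc := hl.cos
  have hS : HasDerivAt (fun t : ℝ => Si (π * t)) (Real.sin (π * X) / (π * X) * π) X :=
    (Si_hasDerivAt (π * X) (by positivity)).comp X hl
  have hP := (hS.const_mul 2).const_sub π
  have hi := hasDerivAt_id X
  have hF := (((hi.const_mul 2).sub ((hs.mul hc).div_const π)).add
    (((hi.mul hs).mul hP).div_const 2)).sub
      ((hs.pow 2).div (hi.const_mul (π ^ 2)) (by simp only [id]; positivity))
  have hF2 := hF.congr_of_eventuallyEq (f₁ := deriv fun t => t ^ 2 * rho0COE t) (by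
    filter_upwards [lt_mem_nhds hX] with t ht
    rw [(first_deriv t ht).deriv]
    simp only [Pi.add_apply, Pi.sub_apply, Pi.mul_apply, Pi.pow_apply, Pi.div_apply, id])
  refine hF2.congr_deriv ?_
  simp only [rho1COE, Pi.add_apply, Pi.sub_apply, Pi.mul_apply, Pi.pow_apply, id]
  have h1 := Real.sin_sq_add_cos_sq (π * X)
  field_simp
  generalize Real.sin (π * X) = s at *
  generalize Real.cos (π * X) = c at *
  generalize Si (π * X) = S at *
  have h2 : c ^ 2 = 1 - s ^ 2 := by linarith
  ring_nf
  simp only [h2]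
  ring

/-- The `N⁻²` correction of the bulk-scaled COE two-point correlation function is given by
`ρ₁ = −(1/6)(d²/dX²)(X²ρ₀)`. -/
theorem coe_two_point_correction_differential_relation :
    ∀ X : ℝ, 0 < X →
      DifferentiableAt ℝ (fun t => t ^ 2 * rho0COE t) X ∧
      DifferentiableAt ℝ (deriv fun t => t ^ 2 * rho0COE t) X ∧
      rho1COE X = -(1 / 6) * deriv (deriv fun t => t ^ 2 * rho0COE t) X := by
  intro X hX
  refine ⟨(first_deriv X hX).differentiableAt, (second_deriv X hX).differentiableAt, ?_⟩
  rw [(second_deriv X hX).deriv]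
  ring
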